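/- (CBV full preservation.) Let t, u be CBV terms and s' a λ!-term. (1) Stability: if tᵛ →F* s' and s' is a →F,d!-normal form, then s' = sᵛ for some CBV term s. (2) Normal forms: t is a →ᵛF-normal form if and only if tᵛ is a →F-normal form. (3) Simulations: t →ᵛF* u if and only if tᵛ →F* uᵛ; moreover, the corresponding reduction sequences contain the same number of dB-steps (resp. the number of sV-steps on the CBV side equals the number of s!-steps on the λ! side). -/

import Mathlib

namespace BangPaper

/-! ### Generic rewriting notions -/

/-- `a` is a normal form for the relation `r`. -/
def IsNF {α : Type*} (r : α → α → Prop) (a : α) : Prop := ∀ b, ¬ r a b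

/-- Reflexive-transitive closure of the union of two relations,
counting the number of steps of each. -/
inductive Counted2 {α : Type*} (r₁ r₂ : α → α → Prop) : ℕ → ℕ → α → α → Prop
  | refl (t : α) : Counted2 r₁ r₂ 0 0 t t
  | step₁ {t u v : α} {m n : ℕ} :
      r₁ t u → Counted2 r₁ r₂ m n u v → Counted2 r₁ r₂ (m + 1) n t v
  | step₂ {t u v : α} {m n : ℕ} :
      r₂ t u → Counted2 r₁ r₂ m n u v → Counted2 r₁ r₂ m (n + 1) t v

/-- Reflexive-transitive closure of the union of three relations,
counting the number of steps of each. -/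
inductive Counted3 {α : Type*} (r₁ r₂ r₃ : α → α → Prop) : ℕ → ℕ → ℕ → α → α → Prop
  | refl (t : α) : Counted3 r₁ r₂ r₃ 0 0 0 t t
  | step₁ {t u v : α} {m n k : ℕ} :
      r₁ t u → Counted3 r₁ r₂ r₃ m n k u v → Counted3 r₁ r₂ r₃ (m + 1) n k t v
  | step₂ {t u v : α} {m n k : ℕ} :
      r₂ t u → Counted3 r₁ r₂ r₃ m n k u v → Counted3 r₁ r₂ r₃ m (n + 1) k t v
  | step₃ {t u v : α} {m n k : ℕ} :
      r₃ t u → Counted3 r₁ r₂ r₃ m n k u v → Counted3 r₁ r₂ r₃ m n (k + 1) t v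

/-! ### Terms of the distant Bang calculus λ! (de Bruijn representation) -/

/-- Terms of λ!: variables, application, abstraction, bang, dereliction and
explicit substitution (`sub t u` is `t[x←u]`, the binder being in `t`). -/
inductive T : Type
  | var : ℕ → T
  | app : T → T → T
  | lam : T → T
  | bang : T → T
  | der : T → T
  | sub : T → T → T

namespace T

/-- Lift (shift by one) the free de Bruijn variables `≥ k`. -/
def lift (k : ℕ) : T → T
  | var n => if n < k then var n else var (n + 1)
  | app a b => app (lift k a) (lift k b)
  | lam a => lam (lift (k + 1) a)
  | bang a => bang (lift k a)
  | der a => der (lift k a)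
  | sub a b => sub (lift (k + 1) a) (lift k b)

/-- Lift all free variables by `m` (crossing `m` binders). -/
def liftN (m : ℕ) (t : T) : T := (lift 0)^[m] t

/-- Lift all free variables except the first one by `m`
(used to push a term with one distinguished bound variable under `m` extra binders). -/
def liftUnder (m : ℕ) (t : T) : T := (lift 1)^[m] t

/-- Capture-avoiding substitution `t{k := u}` of `u` for de Bruijn variable `k`. -/
def subst : T → ℕ → T → T
  | var n, k, u => if n < k then var n else if n = k then liftN k u else var (n - 1)
  | app a b, k, u => app (subst a k u) (subst b k u)
  | lam a, k, u => lam (subst a (k + 1) u)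
  | bang a, k, u => bang (subst a k u)
  | der a, k, u => der (subst a k u)
  | sub a b, k, u => sub (subst a (k + 1) u) (subst b k u)

/-- The number of constructors (full size) of a term: it counts all
applications, abstractions, explicit substitutions, `!` and `der` occurrences. -/
def size : T → ℕ
  | var _ => 0
  | app a b => 1 + size a + size b
  | lam a => 1 + size a
  | bang a => 1 + size a
  | der a => 1 + size a
  | sub a b => 1 + size a + size b

end T

/-- Plugging a term into a list context `⟨·⟩[x₁←t₁]…[xₙ←tₙ]`
(represented as the list `[t₁, …, tₙ]`). -/
def fillL : T → List T → T
  | s, [] => s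
  | s, t :: L => fillL (T.sub s t) L

/-! ### Rewrite rules of λ! -/

/-- The names of the three rewrite rules of λ!: `dB`, `s!` and `d!`. -/
inductive Rule : Type
  | dB : Rule
  | sBang : Rule
  | dBang : Rule

/-- Root steps of the three rewrite rules of λ! (at a distance, capture-free):
`(dB)  L⟨λx.t⟩ u ↦ L⟨t[x←u]⟩`, `(s!)  t[x←L⟨!u⟩] ↦ L⟨t{x:=u}⟩`,
`(d!)  der(L⟨!t⟩) ↦ L⟨t⟩`. -/
inductive Root : Rule → T → T → Prop
  | dB (t u : T) (L : List T) :
      Root Rule.dB (T.app (fillL (T.lam t) L) u)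
        (fillL (T.sub t (T.liftN L.length u)) L)
  | sBang (t u : T) (L : List T) :
      Root Rule.sBang (T.sub t (fillL (T.bang u) L))
        (fillL (T.subst (T.liftUnder L.length t) 0 u) L)
  | dBang (t : T) (L : List T) :
      Root Rule.dBang (T.der (fillL (T.bang t) L)) (fillL t L)

/-! ### Contexts of λ! -/

/-- (Full) contexts of λ!: terms with exactly one hole, the hole may occur anywhere. -/
inductive Ctx : Type
  | hole : Ctx
  | appL : Ctx → T → Ctx
  | appR : T → Ctx → Ctx
  | lam : Ctx → Ctx
  | bang : Ctx → Ctx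
  | der : Ctx → Ctx
  | subL : Ctx → T → Ctx
  | subR : T → Ctx → Ctx

namespace Ctx

/-- Plugging a term in a context (possibly capturing its free variables). -/
def fill : Ctx → T → T
  | hole, s => s
  | appL C t, s => T.app (fill C s) t
  | appR t C, s => T.app t (fill C s)
  | lam C, s => T.lam (fill C s)
  | bang C, s => T.bang (fill C s)
  | der C, s => T.der (fill C s)
  | subL C t, s => T.sub (fill C s) t
  | subR t C, s => T.sub t (fill C s)

/-- Surface contexts: the hole does not occur under a `!`. -/
def Surface : Ctx → Prop
  | hole => True
  | appL C _ => Surface C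
  | appR _ C => Surface C
  | lam C => Surface C
  | bang _ => False
  | der C => Surface C
  | subL C _ => Surface C
  | subR _ C => Surface C

/-- Internal contexts: the full contexts that are not surface (the hole occurs under a `!`). -/
def Internal (C : Ctx) : Prop := ¬ Surface C

end Ctx

/-! ### Reductions of λ! -/

/-- `StepAt R C t u`: `t` rewrites to `u` by firing a redex of rule `R` under context `C`. -/
def StepAt (R : Rule) (C : Ctx) (t u : T) : Prop :=
  ∃ a b, Root R a b ∧ t = C.fill a ∧ u = C.fill b

/-- One step of rule `R` under some full context (`→F,R`). -/
def FStepR (R : Rule) (t u : T) : Prop := ∃ C : Ctx, StepAt R C t u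

/-- One step of rule `R` under some surface context (`→S,R`). -/
def SStepR (R : Rule) (t u : T) : Prop := ∃ C : Ctx, C.Surface ∧ StepAt R C t u

/-- One step of rule `R` under some internal context (`→I,R`). -/
def IStepR (R : Rule) (t u : T) : Prop := ∃ C : Ctx, C.Internal ∧ StepAt R C t u

/-- Full reduction `→F` of λ!. -/
def FStep (t u : T) : Prop := ∃ R, FStepR R t u

/-- Surface reduction `→S` of λ!. -/
def SStep (t u : T) : Prop := ∃ R, SStepR R t u

/-- Internal reduction `→I` of λ!. -/
def IStep (t u : T) : Prop := ∃ R, IStepR R t u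

/-- Diligent administrative surface reduction `→Sai`: `d!`-surface steps, together with
`dB`- and `s!`-surface steps whose source is a `→S,d!`-normal form. -/
def SaiStep (t u : T) : Prop :=
  SStepR Rule.dBang t u ∨
    ((SStepR Rule.dB t u ∨ SStepR Rule.sBang t u) ∧ IsNF (SStepR Rule.dBang) t)

/-- Diligent administrative full reduction `→Fai`: `d!`-full steps, together with
`dB`- and `s!`-full steps whose source is a `→F,d!`-normal form. -/
def FaiStep (t u : T) : Prop :=
  FStepR Rule.dBang t u ∨
    ((FStepR Rule.dB t u ∨ FStepR Rule.sBang t u) ∧ IsNF (FStepR Rule.dBang) t)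

/-! ### Terms of the CBN / CBV calculi (shared syntax, de Bruijn) -/

/-- Terms of the CBN/CBV calculi: variables, application, abstraction and
explicit substitution (no `!`, no `der`). -/
inductive LT : Type
  | var : ℕ → LT
  | app : LT → LT → LT
  | lam : LT → LT
  | sub : LT → LT → LT

namespace LT

/-- Lift (shift by one) the free de Bruijn variables `≥ k`. -/
def lift (k : ℕ) : LT → LT
  | var n => if n < k then var n else var (n + 1)
  | app a b => app (lift k a) (lift k b)
  | lam a => lam (lift (k + 1) a)
  | sub a b => sub (lift (k + 1) a) (lift k b)

/-- Lift all free variables by `m`. -/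
def liftN (m : ℕ) (t : LT) : LT := (lift 0)^[m] t

/-- Lift all free variables except the first one by `m`. -/
def liftUnder (m : ℕ) (t : LT) : LT := (lift 1)^[m] t

/-- Capture-avoiding substitution `t{k := u}`. -/
def subst : LT → ℕ → LT → LT
  | var n, k, u => if n < k then var n else if n = k then liftN k u else var (n - 1)
  | app a b, k, u => app (subst a k u) (subst b k u)
  | lam a, k, u => lam (subst a (k + 1) u)
  | sub a b, k, u => sub (subst a (k + 1) u) (subst b k u)

/-- Values: variables and abstractions. -/
def IsValue : LT → Prop
  | var _ => True
  | lam _ => True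
  | _ => False

end LT

/-- Plugging a CBN/CBV term into a list context. -/
def fillLN : LT → List LT → LT
  | s, [] => s
  | s, t :: L => fillLN (LT.sub s t) L

/-- The names of the CBN rewrite rules: `dB` and `s`. -/
inductive NRule : Type
  | dB : NRule
  | s : NRule

/-- Root steps of the CBN rules:
`(dB) L⟨λx.t⟩ u ↦ L⟨t[x←u]⟩` and `(s) t[x←u] ↦ t{x:=u}`. -/
inductive NRoot : NRule → LT → LT → Prop
  | dB (t u : LT) (L : List LT) :
      NRoot NRule.dB (LT.app (fillLN (LT.lam t) L) u)
        (fillLN (LT.sub t (LT.liftN L.length u)) L)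
  | s (t u : LT) : NRoot NRule.s (LT.sub t u) (LT.subst t 0 u)

/-- The names of the CBV rewrite rules: `dB` and `sV`. -/
inductive VRule : Type
  | dB : VRule
  | sV : VRule

/-- Root steps of the CBV rules:
`(dB) L⟨λx.t⟩ u ↦ L⟨t[x←u]⟩` and `(sV) t[x←L⟨v⟩] ↦ L⟨t{x:=v}⟩` for `v` a value. -/
inductive VRoot : VRule → LT → LT → Prop
  | dB (t u : LT) (L : List LT) :
      VRoot VRule.dB (LT.app (fillLN (LT.lam t) L) u)
        (fillLN (LT.sub t (LT.liftN L.length u)) L)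
  | sV (t v : LT) (L : List LT) : v.IsValue →
      VRoot VRule.sV (LT.sub t (fillLN v L))
        (fillLN (LT.subst (LT.liftUnder L.length t) 0 v) L)

/-- (Full) contexts of the CBN/CBV calculi. -/
inductive LCtx : Type
  | hole : LCtx
  | appL : LCtx → LT → LCtx
  | appR : LT → LCtx → LCtx
  | lam : LCtx → LCtx
  | subL : LCtx → LT → LCtx
  | subR : LT → LCtx → LCtx

namespace LCtx

/-- Plugging a term in a CBN/CBV context. -/
def fill : LCtx → LT → LT
  | hole, s => s
  | appL C t, s => LT.app (fill C s) t
  | appR t C, s => LT.app t (fill C s)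
  | lam C, s => LT.lam (fill C s)
  | subL C t, s => LT.sub (fill C s) t
  | subR t C, s => LT.sub t (fill C s)

/-- CBN surface contexts: the hole never occurs in the argument of an application
or of an explicit substitution. -/
def NSurface : LCtx → Prop
  | hole => True
  | appL C _ => NSurface C
  | appR _ _ => False
  | lam C => NSurface C
  | subL C _ => NSurface C
  | subR _ _ => False

/-- CBV surface contexts: the hole never occurs under an abstraction. -/
def VSurface : LCtx → Prop
  | hole => True
  | appL C _ => VSurface C
  | appR _ C => VSurface C
  | lam _ => False
  | subL C _ => VSurface C
  | subR _ C => VSurface C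

end LCtx

/-- `NStepAt R C t u`: the CBN step firing rule `R` under context `C`. -/
def NStepAt (R : NRule) (C : LCtx) (t u : LT) : Prop :=
  ∃ a b, NRoot R a b ∧ t = C.fill a ∧ u = C.fill b

/-- `VStepAt R C t u`: the CBV step firing rule `R` under context `C`. -/
def VStepAt (R : VRule) (C : LCtx) (t u : LT) : Prop :=
  ∃ a b, VRoot R a b ∧ t = C.fill a ∧ u = C.fill b

/-- One CBN step of rule `R` under some full context. -/
def NFStepR (R : NRule) (t u : LT) : Prop := ∃ C : LCtx, NStepAt R C t u

/-- One CBN step of rule `R` under some surface context. -/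
def NSStepR (R : NRule) (t u : LT) : Prop := ∃ C : LCtx, C.NSurface ∧ NStepAt R C t u

/-- One CBN step of rule `R` under some internal context. -/
def NIStepR (R : NRule) (t u : LT) : Prop := ∃ C : LCtx, ¬ C.NSurface ∧ NStepAt R C t u

/-- CBN full reduction `→ⁿF`. -/
def NFStep (t u : LT) : Prop := ∃ R, NFStepR R t u

/-- CBN surface reduction `→ⁿS`. -/
def NSStep (t u : LT) : Prop := ∃ R, NSStepR R t u

/-- CBN internal reduction `→ⁿI`. -/
def NIStep (t u : LT) : Prop := ∃ R, NIStepR R t u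

/-- One CBV step of rule `R` under some full context. -/
def VFStepR (R : VRule) (t u : LT) : Prop := ∃ C : LCtx, VStepAt R C t u

/-- One CBV step of rule `R` under some surface context. -/
def VSStepR (R : VRule) (t u : LT) : Prop := ∃ C : LCtx, C.VSurface ∧ VStepAt R C t u

/-- One CBV step of rule `R` under some internal context. -/
def VIStepR (R : VRule) (t u : LT) : Prop := ∃ C : LCtx, ¬ C.VSurface ∧ VStepAt R C t u

/-- CBV full reduction `→ᵛF`. -/
def VFStep (t u : LT) : Prop := ∃ R, VFStepR R t u

/-- CBV surface reduction `→ᵛS`. -/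
def VSStep (t u : LT) : Prop := ∃ R, VSStepR R t u

/-- CBV internal reduction `→ᵛI`. -/
def VIStep (t u : LT) : Prop := ∃ R, VIStepR R t u

/-! ### The CBN embedding into λ! -/

/-- The CBN embedding `(·)ⁿ : xⁿ = x, (λx.t)ⁿ = λx.tⁿ, (t u)ⁿ = tⁿ !(uⁿ),
(t[x←u])ⁿ = tⁿ[x←!(uⁿ)]`. -/
def embN : LT → T
  | LT.var n => T.var n
  | LT.app t u => T.app (embN t) (T.bang (embN u))
  | LT.lam t => T.lam (embN t)
  | LT.sub t u => T.sub (embN t) (T.bang (embN u))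

/-- The CBN embedding extended to contexts, with `⟨·⟩ⁿ = ⟨·⟩`. -/
def embNC : LCtx → Ctx
  | LCtx.hole => Ctx.hole
  | LCtx.appL C t => Ctx.appL (embNC C) (T.bang (embN t))
  | LCtx.appR t C => Ctx.appR (embN t) (Ctx.bang (embNC C))
  | LCtx.lam C => Ctx.lam (embNC C)
  | LCtx.subL C t => Ctx.subL (embNC C) (T.bang (embN t))
  | LCtx.subR t C => Ctx.subR (embN t) (Ctx.bang (embNC C))

/-- The CBN embedding on rule names: `dBⁿ = dB`, `sⁿ = s!`. -/
def embNRule : NRule → Rule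
  | NRule.dB => Rule.dB
  | NRule.s => Rule.sBang

/-! ### The CBV embedding into λ! -/

/-- If `t = L⟨!s⟩` for a list context `L`, return `some L⟨s⟩`, otherwise `none`. -/
def strip? : T → Option T
  | T.bang s => some s
  | T.sub a b => (strip? a).map (fun a' => T.sub a' b)
  | _ => none

/-- The (new) CBV embedding `(·)ᵛ : xᵛ = !x, (λx.t)ᵛ = !λx.!(tᵛ),
(t u)ᵛ = der(L⟨s⟩ uᵛ)` if `tᵛ = L⟨!s⟩` and `der(der(tᵛ) uᵛ)` otherwise,
`(t[x←u])ᵛ = tᵛ[x←uᵛ]`. -/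
def embV : LT → T
  | LT.var n => T.bang (T.var n)
  | LT.lam t => T.bang (T.lam (T.bang (embV t)))
  | LT.app t u =>
      match strip? (embV t) with
      | some s => T.der (T.app s (embV u))
      | none => T.der (T.app (T.der (embV t)) (embV u))
  | LT.sub t u => T.sub (embV t) (embV u)

/-- The CBV embedding on rule names: `dBᵛ = dB`, `sVᵛ = s!`. -/
def embVRule : VRule → Rule
  | VRule.dB => Rule.dB
  | VRule.sV => Rule.sBang

/-! ### Inductive presentation of the contextual closures -/

/-- Contextual closure of the rule `R` of λ!, presented by congruence rules. -/
inductive Step (R : Rule) : T → T → Prop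
  | root {a b : T} : Root R a b → Step R a b
  | appL {a a' : T} (b : T) : Step R a a' → Step R (T.app a b) (T.app a' b)
  | appR (a : T) {b b' : T} : Step R b b' → Step R (T.app a b) (T.app a b')
  | lam {a a' : T} : Step R a a' → Step R (T.lam a) (T.lam a')
  | bang {a a' : T} : Step R a a' → Step R (T.bang a) (T.bang a')
  | der {a a' : T} : Step R a a' → Step R (T.der a) (T.der a')
  | subL {a a' : T} (b : T) : Step R a a' → Step R (T.sub a b) (T.sub a' b)
  | subR (a : T) {b b' : T} : Step R b b' → Step R (T.sub a b) (T.sub a b')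

theorem Step.fill {R : Rule} {a b : T} (h : Step R a b) (C : Ctx) :
    Step R (C.fill a) (C.fill b) := by
  induction C with
  | hole => exact h
  | appL C t ih => exact ih.appL t
  | appR t C ih => exact ih.appR t
  | lam C ih => exact ih.lam
  | bang C ih => exact ih.bang
  | der C ih => exact ih.der
  | subL C t ih => exact ih.subL t
  | subR t C ih => exact ih.subR t

theorem fStepR_iff_step {R : Rule} {s s' : T} : FStepR R s s' ↔ Step R s s' := by
  constructor
  · rintro ⟨C, a, b, hab, rfl, rfl⟩
    exact (Step.root hab).fill C
  · intro h
    induction h with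
    | root h => exact ⟨.hole, _, _, h, rfl, rfl⟩
    | appL b _ ih => obtain ⟨C, x, y, h, rfl, rfl⟩ := ih; exact ⟨.appL C b, x, y, h, rfl, rfl⟩
    | appR b _ ih => obtain ⟨C, x, y, h, rfl, rfl⟩ := ih; exact ⟨.appR b C, x, y, h, rfl, rfl⟩
    | lam _ ih => obtain ⟨C, x, y, h, rfl, rfl⟩ := ih; exact ⟨.lam C, x, y, h, rfl, rfl⟩
    | bang _ ih => obtain ⟨C, x, y, h, rfl, rfl⟩ := ih; exact ⟨.bang C, x, y, h, rfl, rfl⟩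
    | der _ ih => obtain ⟨C, x, y, h, rfl, rfl⟩ := ih; exact ⟨.der C, x, y, h, rfl, rfl⟩
    | subL b _ ih => obtain ⟨C, x, y, h, rfl, rfl⟩ := ih; exact ⟨.subL C b, x, y, h, rfl, rfl⟩
    | subR b _ ih => obtain ⟨C, x, y, h, rfl, rfl⟩ := ih; exact ⟨.subR b C, x, y, h, rfl, rfl⟩

theorem fStepR_eq_step (R : Rule) : FStepR R = Step R := by
  funext s s'
  exact propext fStepR_iff_step

namespace VFStepR

variable {R : VRule} {a a' : LT}

theorem root (h : VRoot R a a') : VFStepR R a a' := ⟨.hole, _, _, h, rfl, rfl⟩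

theorem appL (b : LT) (h : VFStepR R a a') : VFStepR R (a.app b) (a'.app b) := by
  obtain ⟨C, x, y, h, rfl, rfl⟩ := h
  exact ⟨.appL C b, x, y, h, rfl, rfl⟩

theorem appR (b : LT) (h : VFStepR R a a') : VFStepR R (b.app a) (b.app a') := by
  obtain ⟨C, x, y, h, rfl, rfl⟩ := h
  exact ⟨.appR b C, x, y, h, rfl, rfl⟩

theorem lam (h : VFStepR R a a') : VFStepR R a.lam a'.lam := by
  obtain ⟨C, x, y, h, rfl, rfl⟩ := h
  exact ⟨.lam C, x, y, h, rfl, rfl⟩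

theorem subL (b : LT) (h : VFStepR R a a') : VFStepR R (a.sub b) (a'.sub b) := by
  obtain ⟨C, x, y, h, rfl, rfl⟩ := h
  exact ⟨.subL C b, x, y, h, rfl, rfl⟩

theorem subR (b : LT) (h : VFStepR R a a') : VFStepR R (b.sub a) (b.sub a') := by
  obtain ⟨C, x, y, h, rfl, rfl⟩ := h
  exact ⟨.subR b C, x, y, h, rfl, rfl⟩

end VFStepR

/-! ### Counted reductions and reflexive-transitive closures -/

theorem Counted2.reflTransGen {t u : LT} {m n : ℕ}
    (h : Counted2 (VFStepR .dB) (VFStepR .sV) m n t u) : Relation.ReflTransGen VFStep t u := by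
  induction h with
  | refl => exact .refl
  | step₁ h _ ih => exact .head ⟨_, h⟩ ih
  | step₂ h _ ih => exact .head ⟨_, h⟩ ih

theorem exists_counted2 {t u : LT} (h : Relation.ReflTransGen VFStep t u) :
    ∃ m n, Counted2 (VFStepR .dB) (VFStepR .sV) m n t u := by
  induction h using Relation.ReflTransGen.head_induction_on with
  | refl => exact ⟨0, 0, .refl _⟩
  | head h _ ih =>
    obtain ⟨m, n, ih⟩ := ih
    obtain ⟨R, h⟩ := h
    cases R
    · exact ⟨_, _, .step₁ h ih⟩
    · exact ⟨_, _, .step₂ h ih⟩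

theorem Counted3.reflTransGen {s s' : T} {m n k : ℕ}
    (h : Counted3 (FStepR .dB) (FStepR .sBang) (FStepR .dBang) m n k s s') :
    Relation.ReflTransGen FStep s s' := by
  induction h with
  | refl => exact .refl
  | step₁ h _ ih => exact .head ⟨_, h⟩ ih
  | step₂ h _ ih => exact .head ⟨_, h⟩ ih
  | step₃ h _ ih => exact .head ⟨_, h⟩ ih

theorem exists_counted3 {s s' : T} (h : Relation.ReflTransGen FStep s s') :
    ∃ m n k, Counted3 (FStepR .dB) (FStepR .sBang) (FStepR .dBang) m n k s s' := by
  induction h using Relation.ReflTransGen.head_induction_on with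
  | refl => exact ⟨0, 0, 0, .refl _⟩
  | head h _ ih =>
    obtain ⟨m, n, k, ih⟩ := ih
    obtain ⟨R, h⟩ := h
    cases R
    · exact ⟨_, _, _, .step₁ h ih⟩
    · exact ⟨_, _, _, .step₂ h ih⟩
    · exact ⟨_, _, _, .step₃ h ih⟩

/-! ### List contexts -/

theorem fillL_concat (s b : T) (L : List T) : fillL s (L ++ [b]) = T.sub (fillL s L) b := by
  induction L generalizing s with
  | nil => rfl
  | cons a L ih => exact ih _

/-- A filled list context is either its content or an explicit substitution. -/
theorem fillL_eq_or (s : T) (L : List T) : fillL s L = s ∨ ∃ a b, fillL s L = T.sub a b := by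
  induction L using List.reverseRecOn with
  | nil => exact .inl rfl
  | append_singleton L b _ => exact .inr ⟨_, _, fillL_concat s b L⟩

theorem strip?_fillL {s h : T} (hs : strip? s = some h) (L : List T) :
    strip? (fillL s L) = some (fillL h L) := by
  induction L generalizing s h with
  | nil => exact hs
  | cons a L ih => exact ih (by simp [strip?, hs])

theorem strip?_eq_some {s h : T} (hs : strip? s = some h) :
    ∃ r L, s = fillL (T.bang r) L ∧ h = fillL r L := by
  induction s generalizing h with
  | bang r => exact ⟨r, [], rfl, by simpa [strip?, fillL] using hs.symm⟩
  | sub a b iha _ =>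
    simp only [strip?, Option.map_eq_some_iff] at hs
    obtain ⟨a', ha, rfl⟩ := hs
    obtain ⟨r, L, rfl, rfl⟩ := iha ha
    exact ⟨r, L ++ [b], (fillL_concat _ _ _).symm, (fillL_concat _ _ _).symm⟩
  | _ => simp [strip?] at hs

theorem embV_fillLN (t : LT) (L : List LT) : embV (fillLN t L) = fillL (embV t) (L.map embV) := by
  induction L generalizing t with
  | nil => rfl
  | cons a L ih => exact ih _

theorem size_fillL_lt {a b : T} (h : a.size < b.size) (L : List T) :
    (fillL a L).size < (fillL b L).size := by
  induction L generalizing a b with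
  | nil => exact h
  | cons c L ih => exact ih (by simp only [T.size]; omega)

theorem Step.size_lt {s s' : T} (h : Step .dBang s s') : s'.size < s.size := by
  induction h with
  | root h =>
    cases h with
    | dBang t L =>
      have := size_fillL_lt (a := t) (b := t.bang) (by simp [T.size]) L
      simp only [T.size]; omega
  | _ => simp only [T.size]; omega

theorem T.lift_iterate_bang (j k : ℕ) (h : T) :
    T.bang ((T.lift j)^[k] h) = (T.lift j)^[k] (T.bang h) := by
  induction k generalizing h with
  | zero => rfl
  | succ k ih => exact ih _

/-! ### Refinement of CBV terms by λ!-terms -/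

/-- The three ways a λ!-term may stand for a CBV term `t`: `comp` for a `d!`-expansion
of `embV t`, `ans` for `L⟨h⟩` where `L⟨!h⟩` stands for `t`, and `pend` for
`L⟨!s⟩` where `L⟨s⟩` stands for `t`. -/
inductive Mode : Type
  | comp : Mode
  | ans : Mode
  | pend : Mode

/-- `Ref m s t`: the λ!-term `s` stands for the CBV term `t` in mode `m`. -/
inductive Ref : Mode → T → LT → Prop
  | var (n : ℕ) : Ref .comp (T.bang (T.var n)) (LT.var n)
  | lam {s : T} {t : LT} : Ref .comp s t → Ref .comp (T.bang (T.lam (T.bang s))) (LT.lam t)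
  | ansVar (n : ℕ) : Ref .ans (T.var n) (LT.var n)
  | ansLam {s : T} {t : LT} : Ref .comp s t → Ref .ans (T.lam (T.bang s)) (LT.lam t)
  | sub {m : Mode} {s r : T} {t u : LT} :
      Ref m s t → Ref .comp r u → Ref m (T.sub s r) (LT.sub t u)
  | appAns {s r : T} {t u : LT} :
      Ref .ans s t → Ref .comp r u → Ref .comp (T.der (T.app s r)) (LT.app t u)
  | appDer {s r : T} {t u : LT} :
      Ref .comp s t → Ref .comp r u → Ref .comp (T.der (T.app (T.der s) r)) (LT.app t u)
  | der {s : T} {t : LT} : Ref .pend s t → Ref .comp (T.der s) t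
  | bang {s : T} {t : LT} : Ref .comp s t → Ref .pend (T.bang s) t

namespace Ref

theorem lift {m : Mode} {s : T} {t : LT} (h : Ref m s t) (k : ℕ) :
    Ref m (s.lift k) (t.lift k) := by
  induction h generalizing k with
  | var n => simp only [T.lift, LT.lift]; split <;> exact .var _
  | lam _ ih => exact .lam (ih _)
  | ansVar n => simp only [T.lift, LT.lift]; split <;> exact .ansVar _
  | ansLam _ ih => exact .ansLam (ih _)
  | sub _ _ ih₁ ih₂ => exact .sub (ih₁ _) (ih₂ _)
  | appAns _ _ ih₁ ih₂ => exact .appAns (ih₁ _) (ih₂ _)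
  | appDer _ _ ih₁ ih₂ => exact .appDer (ih₁ _) (ih₂ _)
  | der _ ih => exact .der (ih _)
  | bang _ ih => exact .bang (ih _)

theorem lift_iterate {m : Mode} {s : T} {t : LT} (h : Ref m s t) (j k : ℕ) :
    Ref m ((T.lift j)^[k] s) ((LT.lift j)^[k] t) := by
  induction k generalizing s t with
  | zero => exact h
  | succ k ih => exact ih (h.lift j)

theorem ans_of_bang {s : T} {t : LT} (h : Ref .comp (T.bang s) t) : Ref .ans s t := by
  cases h with
  | var n => exact .ansVar n
  | lam h => exact .ansLam h

theorem isValue_of_bang {s : T} {t : LT} (h : Ref .comp (T.bang s) t) : t.IsValue := by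
  cases h <;> trivial

theorem subst {m : Mode} {s r : T} {t v : LT} (h : Ref m s t) (hr : Ref .comp (T.bang r) v)
    (k : ℕ) : Ref m (s.subst k r) (t.subst k v) := by
  have hr' (k : ℕ) : Ref .comp (T.bang (T.liftN k r)) (LT.liftN k v) := by
    unfold T.liftN
    rw [T.lift_iterate_bang]
    exact hr.lift_iterate 0 k
  induction h generalizing k with
  | var n =>
    simp only [T.subst, LT.subst]
    split_ifs
    exacts [.var _, hr' k, .var _]
  | lam _ ih => exact .lam (ih _)
  | ansVar n =>
    simp only [T.subst, LT.subst]
    split_ifs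
    exacts [.ansVar _, (hr' k).ans_of_bang, .ansVar _]
  | ansLam _ ih => exact .ansLam (ih _)
  | sub _ _ ih₁ ih₂ => exact .sub (ih₁ _) (ih₂ _)
  | appAns _ _ ih₁ ih₂ => exact .appAns (ih₁ _) (ih₂ _)
  | appDer _ _ ih₁ ih₂ => exact .appDer (ih₁ _) (ih₂ _)
  | der _ ih => exact .der (ih _)
  | bang _ ih => exact .bang (ih _)

/-- A refinement of a filled list context splits into a refinement of its content and
a refinement of the list context, in which other contents may be plugged. -/
theorem exists_of_fillL {m : Mode} {s : T} {L : List T} {t : LT} (h : Ref m (fillL s L) t) :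
    ∃ t₀ L', t = fillLN t₀ L' ∧ L'.length = L.length ∧ Ref m s t₀ ∧
      ∀ m' s' t', Ref m' s' t' → Ref m' (fillL s' L) (fillLN t' L') := by
  induction L generalizing s with
  | nil => exact ⟨t, [], rfl, rfl, h, fun _ _ _ h => h⟩
  | cons a L ih =>
    obtain ⟨t₁, L', rfl, hL, h₁, hplug⟩ := ih h
    cases h₁ with
    | sub hs ha => exact ⟨_, _ :: L', rfl, by simp [hL], hs, fun _ _ _ h => hplug _ _ _ (h.sub ha)⟩

theorem ans_of_strip? {s h : T} {t : LT} (hs : Ref .comp s t) (hh : strip? s = some h) :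
    Ref .ans h t := by
  obtain ⟨r, L, rfl, rfl⟩ := strip?_eq_some hh
  obtain ⟨t₀, L', rfl, -, h₀, hplug⟩ := hs.exists_of_fillL
  exact hplug _ _ _ h₀.ans_of_bang

theorem embV (t : LT) : Ref .comp (embV t) t := by
  induction t with
  | var n => exact .var n
  | lam t ih => exact .lam ih
  | sub t u iht ihu => exact .sub iht ihu
  | app t u iht ihu =>
    rw [BangPaper.embV]
    split
    · rename_i h
      exact .appAns (iht.ans_of_strip? h) ihu
    · exact .appDer iht ihu

theorem functional {m : Mode} {s : T} {t t' : LT} (h : Ref m s t) (h' : Ref m s t') : t = t' := by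
  induction h generalizing t' with
  | var n => cases h'; rfl
  | lam _ ih => cases h' with | lam h => rw [ih h]
  | ansVar n => cases h'; rfl
  | ansLam _ ih => cases h' with | ansLam h => rw [ih h]
  | sub _ _ ih₁ ih₂ => cases h' with | sub h₁ h₂ => rw [ih₁ h₁, ih₂ h₂]
  | appAns h _ ih₁ ih₂ =>
    cases h' with
    | appAns h₁ h₂ => rw [ih₁ h₁, ih₂ h₂]
    | appDer h₁ h₂ => cases h
    | der h => cases h
  | appDer _ _ ih₁ ih₂ =>
    cases h' with
    | appAns h₁ h₂ => cases h₁
    | appDer h₁ h₂ => rw [ih₁ h₁, ih₂ h₂]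
    | der h => cases h
  | der h ih =>
    cases h' with
    | appAns h₁ h₂ => cases h
    | appDer h₁ h₂ => cases h
    | der h => exact ih h
  | bang _ ih => cases h' with | bang h => exact ih h

theorem exists_fillL_of_pend {s : T} {t : LT} (h : Ref .pend s t) :
    ∃ r L, s = fillL (T.bang r) L := by
  generalize hm : Mode.pend = m at h
  induction h with
  | sub _ _ ih _ =>
    obtain ⟨r, L, rfl⟩ := ih hm
    exact ⟨r, L ++ [_], (fillL_concat _ _ _).symm⟩
  | bang _ _ => exact ⟨_, [], rfl⟩
  | _ => cases hm

/-- A refinement that is `d!`-normal is the embedding of the term it refines. -/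
theorem eq_embV_of_isNF {s : T} {t : LT} (h : Ref .comp s t) (hs : IsNF (Step .dBang) s) :
    BangPaper.embV t = s := by
  suffices H : ∀ m s t, Ref m s t → IsNF (Step .dBang) s →
      (m = .comp → BangPaper.embV t = s) ∧ (m = .ans → strip? (BangPaper.embV t) = some s) from
    (H _ _ _ h hs).1 rfl
  intro m s t h hs
  induction h with
  | var n => exact ⟨fun _ => rfl, nofun⟩
  | lam _ ih =>
    refine ⟨fun _ => ?_, nofun⟩
    rw [BangPaper.embV, (ih fun _ h => hs _ h.bang.lam.bang).1 rfl]
  | ansVar n => exact ⟨nofun, fun _ => rfl⟩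
  | ansLam _ ih =>
    refine ⟨nofun, fun _ => ?_⟩
    rw [BangPaper.embV, (ih fun _ h => hs _ h.bang.lam).1 rfl]
    rfl
  | sub _ _ ih₁ ih₂ =>
    have h₁ := ih₁ fun _ h => hs _ (h.subL _)
    have h₂ := (ih₂ fun _ h => hs _ (h.subR _)).1 rfl
    refine ⟨fun hm => ?_, fun hm => ?_⟩
    · rw [BangPaper.embV, h₁.1 hm, h₂]
    · rw [BangPaper.embV, strip?, h₁.2 hm, h₂]
      rfl
  | appAns _ _ ih₁ ih₂ =>
    have h₁ := (ih₁ fun _ h => hs _ (h.appL _).der).2 rfl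
    have h₂ := (ih₂ fun _ h => hs _ (h.appR _).der).1 rfl
    refine ⟨fun _ => ?_, nofun⟩
    simp only [BangPaper.embV, h₁, h₂]
  | @appDer s _ _ _ _ _ ih₁ ih₂ =>
    have h₁ := (ih₁ fun _ h => hs _ (h.der.appL _).der).1 rfl
    have h₂ := (ih₂ fun _ h => hs _ (h.appR _).der).1 rfl
    refine ⟨fun _ => ?_, nofun⟩
    have hn : strip? s = none := by
      by_contra hne
      obtain ⟨h, hh⟩ := Option.ne_none_iff_exists'.mp hne
      obtain ⟨r', L, rfl, rfl⟩ := strip?_eq_some hh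
      exact hs _ ((Step.root (.dBang r' L)).appL _).der
    simp only [BangPaper.embV, h₁, hn, h₂]
  | der h _ =>
    obtain ⟨r, L, rfl⟩ := h.exists_fillL_of_pend
    exact absurd (.root (.dBang r L)) (hs _)
  | bang _ _ => exact ⟨nofun, nofun⟩

end Ref

/-! ### Refinement is preserved by reduction -/

/-- The effect on CBV terms of a step of a rule of λ!: none for `d!`, and one step of the
corresponding CBV rule for `dB` and `s!`. -/
def Shadow : Rule → LT → LT → Prop
  | .dB => VFStepR .dB
  | .sBang => VFStepR .sV
  | .dBang => Eq

namespace Shadow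

variable {R : Rule} {a a' : LT}

theorem congr {f : LT → LT} (hf : ∀ R a a', VFStepR R a a' → VFStepR R (f a) (f a'))
    (h : Shadow R a a') : Shadow R (f a) (f a') := by
  cases R
  · exact hf _ _ _ h
  · exact hf _ _ _ h
  · exact congrArg f h

theorem appL (b : LT) (h : Shadow R a a') : Shadow R (a.app b) (a'.app b) :=
  h.congr (f := fun a => a.app b) fun _ _ _ h => h.appL b

theorem appR (b : LT) (h : Shadow R a a') : Shadow R (b.app a) (b.app a') :=
  h.congr fun _ _ _ h => h.appR b

theorem lam (h : Shadow R a a') : Shadow R a.lam a'.lam :=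
  h.congr fun _ _ _ h => h.lam

theorem subL (b : LT) (h : Shadow R a a') : Shadow R (a.sub b) (a'.sub b) :=
  h.congr (f := fun a => a.sub b) fun _ _ _ h => h.subL b

theorem subR (b : LT) (h : Shadow R a a') : Shadow R (b.sub a) (b.sub a') :=
  h.congr fun _ _ _ h => h.subR b

end Shadow

theorem not_step_var {R : Rule} {n : ℕ} {s : T} : ¬ Step R (T.var n) s := by
  rintro (h | _)
  cases h

theorem Step.of_bang {R : Rule} {s r : T} (h : Step R (T.bang s) r) :
    ∃ s', r = T.bang s' ∧ Step R s s' := by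
  cases h with
  | root h => cases h
  | bang h => exact ⟨_, rfl, h⟩

theorem Step.of_lam {R : Rule} {s r : T} (h : Step R (T.lam s) r) :
    ∃ s', r = T.lam s' ∧ Step R s s' := by
  cases h with
  | root h => cases h
  | lam h => exact ⟨_, rfl, h⟩

theorem Step.of_der {R : Rule} {s r : T} (h : Step R (T.der s) r) :
    (∃ s', r = T.der s' ∧ Step R s s') ∨
      ∃ p L, R = .dBang ∧ s = fillL (T.bang p) L ∧ r = fillL p L := by
  cases h with
  | root h =>
    generalize hd : T.der s = d at h
    cases h <;> cases hd
    exact .inr ⟨_, _, rfl, rfl, rfl⟩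
  | der h => exact .inl ⟨_, rfl, h⟩

theorem Step.of_app {R : Rule} {s p r : T} (h : Step R (T.app s p) r) :
    (∃ s', r = T.app s' p ∧ Step R s s') ∨ (∃ p', r = T.app s p' ∧ Step R p p') ∨
      ∃ q L, R = .dB ∧ s = fillL (T.lam q) L ∧ r = fillL (T.sub q (T.liftN L.length p)) L := by
  cases h with
  | root h =>
    generalize hd : T.app s p = d at h
    cases h <;> cases hd
    exact .inr (.inr ⟨_, _, rfl, rfl, rfl⟩)
  | appL _ h => exact .inl ⟨_, rfl, h⟩
  | appR _ h => exact .inr (.inl ⟨_, rfl, h⟩)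

theorem Step.of_sub {R : Rule} {s p r : T} (h : Step R (T.sub s p) r) :
    (∃ s', r = T.sub s' p ∧ Step R s s') ∨ (∃ p', r = T.sub s p' ∧ Step R p p') ∨
      ∃ q L, R = .sBang ∧ p = fillL (T.bang q) L ∧
        r = fillL (T.subst (T.liftUnder L.length s) 0 q) L := by
  cases h with
  | root h =>
    generalize hd : T.sub s p = d at h
    cases h <;> cases hd
    exact .inr (.inr ⟨_, _, rfl, rfl, rfl⟩)
  | subL _ h => exact .inl ⟨_, rfl, h⟩
  | subR _ h => exact .inr (.inl ⟨_, rfl, h⟩)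

theorem app_ne_fillL_bang {a b p : T} {L : List T} : T.app a b ≠ fillL (T.bang p) L := by
  rcases fillL_eq_or (T.bang p) L with h | ⟨_, _, h⟩ <;> simp [h]

theorem der_ne_fillL_lam {a p : T} {L : List T} : T.der a ≠ fillL (T.lam p) L := by
  rcases fillL_eq_or (T.lam p) L with h | ⟨_, _, h⟩ <;> simp [h]

theorem Ref.step {m : Mode} {s s' : T} {t : LT} {R : Rule} (h : Ref m s t) (hs : Step R s s') :
    ∃ t', Shadow R t t' ∧ Ref m s' t' := by
  induction h generalizing s' with
  | var n =>
    obtain ⟨_, rfl, hs₁⟩ := hs.of_bang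
    exact absurd hs₁ not_step_var
  | lam _ ih =>
    obtain ⟨_, rfl, hs₁⟩ := hs.of_bang
    obtain ⟨_, rfl, hs₂⟩ := hs₁.of_lam
    obtain ⟨_, rfl, hs₃⟩ := hs₂.of_bang
    obtain ⟨t', ht, h⟩ := ih hs₃
    exact ⟨_, ht.lam, .lam h⟩
  | ansVar n => exact absurd hs not_step_var
  | ansLam _ ih =>
    obtain ⟨_, rfl, hs₁⟩ := hs.of_lam
    obtain ⟨_, rfl, hs₂⟩ := hs₁.of_bang
    obtain ⟨t', ht, h⟩ := ih hs₂
    exact ⟨_, ht.lam, .ansLam h⟩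
  | @sub _ _ _ t _ h₁ h₂ ih₁ ih₂ =>
    obtain ⟨_, rfl, hs₁⟩ | ⟨_, rfl, hs₁⟩ | ⟨q, L, rfl, rfl, rfl⟩ := hs.of_sub
    · obtain ⟨t', ht, h⟩ := ih₁ hs₁
      exact ⟨_, ht.subL _, .sub h h₂⟩
    · obtain ⟨t', ht, h⟩ := ih₂ hs₁
      exact ⟨_, ht.subR _, .sub h₁ h⟩
    · obtain ⟨v, L', rfl, hL, hv, hplug⟩ := h₂.exists_of_fillL
      refine ⟨_, VFStepR.root (.sV t v L' hv.isValue_of_bang), hplug _ _ _ (Ref.subst ?_ hv 0)⟩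
      rw [hL]
      exact h₁.lift_iterate 1 _
  | @appAns _ _ _ u h₁ h₂ ih₁ ih₂ =>
    obtain ⟨_, rfl, hs₁⟩ | ⟨_, _, _, h, _⟩ := hs.of_der
    · obtain ⟨_, rfl, hs₂⟩ | ⟨_, rfl, hs₂⟩ | ⟨q, L, rfl, rfl, rfl⟩ := hs₁.of_app
      · obtain ⟨t', ht, h⟩ := ih₁ hs₂
        exact ⟨_, ht.appL _, .appAns h h₂⟩
      · obtain ⟨t', ht, h⟩ := ih₂ hs₂
        exact ⟨_, ht.appR _, .appAns h₁ h⟩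
      · obtain ⟨v, L', rfl, hL, hv, hplug⟩ := h₁.exists_of_fillL
        cases hv with
        | ansLam hv =>
          refine ⟨_, VFStepR.root (.dB _ u L'), .der (hplug _ _ _ (.sub (.bang hv) ?_))⟩
          rw [hL]
          exact h₂.lift_iterate 0 _
    · exact absurd h app_ne_fillL_bang
  | appDer h₁ h₂ ih₁ ih₂ =>
    obtain ⟨_, rfl, hs₁⟩ | ⟨_, _, _, h, _⟩ := hs.of_der
    · obtain ⟨_, rfl, hs₂⟩ | ⟨_, rfl, hs₂⟩ | ⟨q, L, rfl, h, rfl⟩ := hs₁.of_app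
      · obtain ⟨_, rfl, hs₃⟩ | ⟨q, L, rfl, rfl, rfl⟩ := hs₂.of_der
        · obtain ⟨t', ht, h⟩ := ih₁ hs₃
          exact ⟨_, ht.appL _, .appDer h h₂⟩
        · exact ⟨_, rfl, .appAns (h₁.ans_of_strip? (strip?_fillL rfl L)) h₂⟩
      · obtain ⟨t', ht, h⟩ := ih₂ hs₂
        exact ⟨_, ht.appR _, .appDer h₁ h⟩
      · exact absurd h der_ne_fillL_lam
    · exact absurd h app_ne_fillL_bang
  | der h ih =>
    obtain ⟨_, rfl, hs₁⟩ | ⟨q, L, rfl, rfl, rfl⟩ := hs.of_der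
    · obtain ⟨t', ht, h⟩ := ih hs₁
      exact ⟨_, ht, .der h⟩
    · obtain ⟨v, L', rfl, -, hv, hplug⟩ := h.exists_of_fillL
      cases hv with
      | bang hv => exact ⟨_, rfl, hplug _ _ _ hv⟩
  | bang _ ih =>
    obtain ⟨_, rfl, hs₁⟩ := hs.of_bang
    obtain ⟨t', ht, h⟩ := ih hs₁
    exact ⟨_, ht, .bang h⟩

theorem Ref.counted {s s' : T} {t : LT} {m n k : ℕ} (h : Ref .comp s t)
    (hs : Counted3 (FStepR .dB) (FStepR .sBang) (FStepR .dBang) m n k s s') :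
    ∃ t', Counted2 (VFStepR .dB) (VFStepR .sV) m n t t' ∧ Ref .comp s' t' := by
  simp only [fStepR_eq_step] at hs
  induction hs generalizing t with
  | refl => exact ⟨t, .refl _, h⟩
  | step₁ hs _ ih =>
    obtain ⟨t₁, ht, h₁⟩ := h.step hs
    obtain ⟨t', ht', h'⟩ := ih h₁
    exact ⟨t', .step₁ ht ht', h'⟩
  | step₂ hs _ ih =>
    obtain ⟨t₁, ht, h₁⟩ := h.step hs
    obtain ⟨t', ht', h'⟩ := ih h₁
    exact ⟨t', .step₂ ht ht', h'⟩
  | step₃ hs _ ih =>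
    obtain ⟨t₁, rfl, h₁⟩ := h.step hs
    exact ih h₁

/-- A refinement of `t` normalizes to `embV t` by `d!`-steps. -/
theorem Ref.reflTransGen_embV {s : T} {t : LT} (h : Ref .comp s t) :
    Relation.ReflTransGen (Step .dBang) s (BangPaper.embV t) := by
  induction hn : s.size using Nat.strong_induction_on generalizing s with
  | _ n ih =>
    by_cases hs : IsNF (Step .dBang) s
    · rw [h.eq_embV_of_isNF hs]
    · simp only [IsNF, not_forall, not_not] at hs
      obtain ⟨s', hs⟩ := hs
      obtain ⟨_, rfl, h'⟩ := h.step hs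
      exact .head hs (ih _ (hn ▸ hs.size_lt) h' rfl)

theorem size_le_of_reflTransGen {s s' : T} (h : Relation.ReflTransGen (Step .dBang) s s') :
    s'.size ≤ s.size := by
  induction h with
  | refl => exact le_rfl
  | tail _ h ih => exact h.size_lt.le.trans ih

theorem isNF_embV (t : LT) : IsNF (Step .dBang) (embV t) := by
  intro s hs
  obtain ⟨_, rfl, h⟩ := (Ref.embV t).step hs
  exact absurd (size_le_of_reflTransGen h.reflTransGen_embV) hs.size_lt.not_ge

theorem Counted3.of_reflTransGen_dBang {s s' w : T} {m n k : ℕ}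
    (h : Relation.ReflTransGen (Step .dBang) s s')
    (hw : Counted3 (FStepR .dB) (FStepR .sBang) (FStepR .dBang) m n k s' w) :
    ∃ k', Counted3 (FStepR .dB) (FStepR .sBang) (FStepR .dBang) m n k' s w := by
  induction h using Relation.ReflTransGen.head_induction_on with
  | refl => exact ⟨k, hw⟩
  | head h _ ih =>
    obtain ⟨k', ih⟩ := ih
    exact ⟨_, .step₃ (fStepR_iff_step.mpr h) ih⟩

/-! ### Simulation of CBV steps -/

theorem strip?_embV_app (t u : LT) : strip? (embV (LT.app t u)) = none := by
  rw [embV]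
  split <;> rfl

theorem exists_embV_eq_bang {v : LT} (hv : v.IsValue) : ∃ h, embV v = T.bang h := by
  cases v with
  | var n => exact ⟨_, rfl⟩
  | lam t => exact ⟨_, rfl⟩
  | _ => exact hv.elim

theorem Ref.fillL_embV {m : Mode} {s : T} {t : LT} (h : Ref m s t) (L : List LT) :
    Ref m (fillL s (L.map BangPaper.embV)) (fillLN t L) := by
  induction L generalizing s t with
  | nil => exact h
  | cons a L ih => exact ih (h.sub (Ref.embV a))

theorem VRoot.exists_step {R : VRule} {t t' : LT} (h : VRoot R t t') :
    (∃ s, Step (embVRule R) (embV t) s ∧ Ref .comp s t') ∧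
      ∀ p, strip? (embV t) = some p → ∃ s, Step (embVRule R) p s ∧ Ref .ans s t' := by
  cases h with
  | dB t u L =>
    refine ⟨?_, fun p hp => by simp [strip?_embV_app] at hp⟩
    have hs : strip? (embV (fillLN (LT.lam t) L)) =
        some (fillL (T.lam (T.bang (embV t))) (L.map embV)) := by
      rw [embV_fillLN]
      exact strip?_fillL rfl _
    simp only [embV, hs]
    refine ⟨_, (Step.root (.dB _ _ _)).der,
      .der (Ref.fillL_embV (.sub (.bang (Ref.embV t)) ?_) L)⟩
    rw [List.length_map]
    exact (Ref.embV u).lift_iterate 0 _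
  | sV t v L hv =>
    obtain ⟨r, hr⟩ := exists_embV_eq_bang hv
    have hrv : Ref .comp (T.bang r) v := hr ▸ Ref.embV v
    have key {m : Mode} {q : T} (hq : Ref m q t) :
        ∃ s, Step .sBang (T.sub q (embV (fillLN v L))) s ∧
          Ref m s (fillLN (LT.subst (LT.liftUnder L.length t) 0 v) L) := by
      rw [embV_fillLN, hr]
      refine ⟨_, .root (.sBang _ _ _), Ref.fillL_embV (Ref.subst ?_ hrv 0) L⟩
      rw [List.length_map]
      exact hq.lift_iterate 1 _
    refine ⟨key (Ref.embV t), fun p hp => ?_⟩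
    simp only [embV, strip?, Option.map_eq_some_iff] at hp
    obtain ⟨q, hq, rfl⟩ := hp
    exact key ((Ref.embV t).ans_of_strip? hq)

theorem VFStepR.exists_step {R : VRule} {t t' : LT} (h : VFStepR R t t') :
    (∃ s, Step (embVRule R) (embV t) s ∧ Ref .comp s t') ∧
      ∀ p, strip? (embV t) = some p → ∃ s, Step (embVRule R) p s ∧ Ref .ans s t' := by
  obtain ⟨C, a, b, h, rfl, rfl⟩ := h
  induction C with
  | hole => exact h.exists_step
  | appL C u ih =>
    refine ⟨?_, fun p hp => by simp [LCtx.fill, strip?_embV_app] at hp⟩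
    obtain ⟨⟨s, hs, hr⟩, ih⟩ := ih
    simp only [LCtx.fill, embV]
    split
    · rename_i p hp
      obtain ⟨s', hs', hr'⟩ := ih p hp
      exact ⟨_, (hs'.appL _).der, .appAns hr' (Ref.embV u)⟩
    · exact ⟨_, (hs.der.appL _).der, .appDer hr (Ref.embV u)⟩
  | appR u C ih =>
    refine ⟨?_, fun p hp => by simp [LCtx.fill, strip?_embV_app] at hp⟩
    obtain ⟨⟨s, hs, hr⟩, -⟩ := ih
    simp only [LCtx.fill, embV]
    split
    · rename_i p hp
      exact ⟨_, (hs.appR _).der, .appAns ((Ref.embV u).ans_of_strip? hp) hr⟩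
    · exact ⟨_, (hs.appR _).der, .appDer (Ref.embV u) hr⟩
  | lam C ih =>
    obtain ⟨⟨s, hs, hr⟩, -⟩ := ih
    refine ⟨⟨_, hs.bang.lam.bang, .lam hr⟩, fun p hp => ?_⟩
    obtain rfl := Option.some.inj hp
    exact ⟨_, hs.bang.lam, .ansLam hr⟩
  | subL C u ih =>
    obtain ⟨⟨s, hs, hr⟩, ih⟩ := ih
    refine ⟨⟨_, hs.subL _, hr.sub (Ref.embV u)⟩, fun p hp => ?_⟩
    simp only [LCtx.fill, embV, strip?, Option.map_eq_some_iff] at hp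
    obtain ⟨q, hq, rfl⟩ := hp
    obtain ⟨s', hs', hr'⟩ := ih q hq
    exact ⟨_, hs'.subL _, hr'.sub (Ref.embV u)⟩
  | subR u C ih =>
    obtain ⟨⟨s, hs, hr⟩, -⟩ := ih
    refine ⟨⟨_, hs.subR _, (Ref.embV u).sub hr⟩, fun p hp => ?_⟩
    simp only [LCtx.fill, embV, strip?, Option.map_eq_some_iff] at hp
    obtain ⟨q, hq, rfl⟩ := hp
    exact ⟨_, hs.subR _, ((Ref.embV u).ans_of_strip? hq).sub hr⟩

theorem Counted2.exists_counted3 {t u : LT} {m n : ℕ}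
    (h : Counted2 (VFStepR .dB) (VFStepR .sV) m n t u) :
    ∃ k, Counted3 (FStepR .dB) (FStepR .sBang) (FStepR .dBang) m n k (embV t) (embV u) := by
  induction h with
  | refl => exact ⟨0, .refl _⟩
  | step₁ h _ ih =>
    obtain ⟨⟨s, hs, hr⟩, -⟩ := h.exists_step
    obtain ⟨k, ih⟩ := ih
    obtain ⟨k', hk⟩ := Counted3.of_reflTransGen_dBang hr.reflTransGen_embV ih
    exact ⟨k', .step₁ (fStepR_iff_step.mpr hs) hk⟩
  | step₂ h _ ih =>
    obtain ⟨⟨s, hs, hr⟩, -⟩ := h.exists_step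
    obtain ⟨k, ih⟩ := ih
    obtain ⟨k', hk⟩ := Counted3.of_reflTransGen_dBang hr.reflTransGen_embV ih
    exact ⟨k', .step₂ (fStepR_iff_step.mpr hs) hk⟩

theorem counted2_iff_exists_counted3 {t u : LT} {m n : ℕ} :
    Counted2 (VFStepR .dB) (VFStepR .sV) m n t u ↔
      ∃ k, Counted3 (FStepR .dB) (FStepR .sBang) (FStepR .dBang) m n k (embV t) (embV u) := by
  refine ⟨fun h => h.exists_counted3, fun ⟨k, h⟩ => ?_⟩
  obtain ⟨t', ht, hr⟩ := (Ref.embV t).counted h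
  rwa [(Ref.embV u).functional hr]

theorem isNF_vFStep_iff {t : LT} : IsNF VFStep t ↔ IsNF FStep (embV t) := by
  constructor
  · rintro h s ⟨R, hs⟩
    rw [fStepR_iff_step] at hs
    obtain ⟨t', ht, -⟩ := (Ref.embV t).step hs
    cases R
    · exact h _ ⟨_, ht⟩
    · exact h _ ⟨_, ht⟩
    · exact isNF_embV t _ hs
  · rintro h u ⟨R, hu⟩
    obtain ⟨⟨s, hs, -⟩, -⟩ := hu.exists_step
    exact h s ⟨_, fStepR_iff_step.mpr hs⟩

/-- **CBV full preservation.**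
(1) Stability: if `tᵛ →F* s'` and `s'` is a `→F,d!`-normal form, then `s' = sᵛ` for
some CBV term `s`.
(2) Normal forms: `t` is a `→ᵛF`-normal form iff `tᵛ` is a `→F`-normal form.
(3) Simulations: `t →ᵛF* u` iff `tᵛ →F* uᵛ`; moreover corresponding sequences have the
same number of `dB`-steps, and the number of `sV`-steps on the CBV side equals the
number of `s!`-steps on the λ! side. -/
theorem cbv_full_preservation (t u : LT) (s' : T) :
    (Relation.ReflTransGen FStep (embV t) s' → IsNF (FStepR Rule.dBang) s' →
      ∃ s : LT, embV s = s') ∧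
    (IsNF VFStep t ↔ IsNF FStep (embV t)) ∧
    (Relation.ReflTransGen VFStep t u ↔
      Relation.ReflTransGen FStep (embV t) (embV u)) ∧
    (∀ m n : ℕ, Counted2 (VFStepR VRule.dB) (VFStepR VRule.sV) m n t u ↔
      ∃ k, Counted3 (FStepR Rule.dB) (FStepR Rule.sBang) (FStepR Rule.dBang)
        m n k (embV t) (embV u)) := by
  refine ⟨fun h hs => ?_, isNF_vFStep_iff, ⟨fun h => ?_, fun h => ?_⟩,
    fun _ _ => counted2_iff_exists_counted3⟩
  · obtain ⟨m, n, k, h⟩ := exists_counted3 h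
    obtain ⟨s, -, hr⟩ := (Ref.embV t).counted h
    rw [fStepR_eq_step] at hs
    exact ⟨s, hr.eq_embV_of_isNF hs⟩
  · obtain ⟨m, n, h⟩ := exists_counted2 h
    obtain ⟨k, h⟩ := h.exists_counted3
    exact h.reflTransGen
  · obtain ⟨m, n, k, h⟩ := exists_counted3 h
    exact (counted2_iff_exists_counted3.mpr ⟨k, h⟩).reflTransGen

end BangPaper
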